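/- arXiv:2010.02410 — 2 statements merged into one kernel-verified Lean document; each statement's English description precedes it below -/
import Mathlib

section
/- Let q be a prime power and 𝔽_q the finite field with q elements. Let t ≥ 3 and d_1 > d_2 > ⋯ > d_t ≥ 2 be integers with char(𝔽_q) not dividing d_i for 1 ≤ i ≤ t. Let a_1, …, a_t ∈ 𝔽_q be all nonzero and let b ∈ 𝔽_q. Let N be the number of tuples x = (x_1, …, x_t) ∈ 𝔽_q^t with a_1 x_1^{d_1} + a_2 x_2^{d_2} + ⋯ + a_t x_t^{d_t} = b. Then |N − q^{t−1}| ≤ q^{t/2} · (6 d_1)^{t+1}. -/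
section CharacterSums

variable {F ι : Type*} [Field F] [Fintype F] [Fintype ι]

open Finset

/-- The number of solutions of `f i = b`, expressed through additive characters. -/
lemma card_mul_card_fiber_eq_sum_addChar [DecidableEq F] {ψ : AddChar F ℂ} (hψ : ψ.IsPrimitive)
    (f : ι → F) (b : F) :
    (Fintype.card F : ℂ) * #{i | f i = b} = ∑ c, ψ (-(c * b)) * ∑ i, ψ (c * f i) := by
  have h (i : ι) : ∑ c, ψ (-(c * b)) * ψ (c * f i) =
      if f i = b then (Fintype.card F : ℂ) else 0 := by
    have := AddChar.sum_mulShift (f i - b) hψ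
    simp only [sub_eq_zero, Nat.cast_ite, Nat.cast_zero] at this
    rw [← this]
    refine sum_congr rfl fun c _ => ?_
    rw [← AddChar.map_add_eq_mul]
    congr 1
    ring
  simp_rw [mul_sum]
  rw [sum_comm]
  simp_rw [h]
  rw [← sum_filter, sum_const, nsmul_eq_mul, mul_comm]

/-- The second moment of the exponential sums attached to `f`. -/
lemma sum_norm_sq_sum_addChar [DecidableEq F] {ψ : AddChar F ℂ} (hψ : ψ.IsPrimitive) (f : ι → F) :
    ∑ c, ‖∑ i, ψ (c * f i)‖ ^ 2 =
      (Fintype.card F : ℝ) * #{p : ι × ι | f p.1 = f p.2} := by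
  have h := card_mul_card_fiber_eq_sum_addChar hψ (fun p : ι × ι => f p.1 - f p.2) 0
  simp only [sub_eq_zero, mul_zero, neg_zero, AddChar.map_zero_eq_one, one_mul] at h
  apply Complex.ofReal_injective
  push_cast
  rw [h]
  refine sum_congr rfl fun c _ => ?_
  rw [← Complex.mul_conj', map_sum, sum_mul_sum, Fintype.sum_prod_type]
  refine sum_congr rfl fun i _ => sum_congr rfl fun j _ => ?_
  rw [← AddChar.map_neg_eq_conj, ← AddChar.map_add_eq_mul]
  congr 1
  ring

/-- If every nontrivial exponential sum of `f` is at most `B`, then `f` takes each value about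
equally often. -/
lemma abs_card_fiber_sub_le [DecidableEq F] {ψ : AddChar F ℂ} (hψ : ψ.IsPrimitive)
    (f : ι → F) (b : F) {B : ℝ} (hB : 0 ≤ B) (h : ∀ c ≠ 0, ‖∑ i, ψ (c * f i)‖ ≤ B) :
    |(#{i | f i = b} : ℝ) - Fintype.card ι / Fintype.card F| ≤ B := by
  have hq : (0 : ℝ) < Fintype.card F := by exact_mod_cast Fintype.card_pos
  have key := card_mul_card_fiber_eq_sum_addChar hψ f b
  rw [← add_sum_erase _ _ (mem_univ (0 : F))] at key
  simp only [zero_mul, neg_zero, AddChar.map_zero_eq_one, sum_const, card_univ, nsmul_eq_mul,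
    mul_one, one_mul] at key
  have hbound : ‖((Fintype.card F * #{i | f i = b} - Fintype.card ι : ℝ) : ℂ)‖
      ≤ Fintype.card F * B := by
    push_cast
    rw [key, add_sub_cancel_left]
    calc _ ≤ ∑ _c ∈ univ.erase (0 : F), B := by
          refine norm_sum_le_of_le _ fun c hc => ?_
          rw [norm_mul, AddChar.norm_apply, one_mul]
          exact h c (ne_of_mem_erase hc)
      _ ≤ ∑ _c : F, B := sum_le_univ_sum_of_nonneg fun _ => hB
      _ = _ := by simp
  rw [Complex.norm_real, Real.norm_eq_abs] at hbound
  rw [← mul_le_mul_iff_right₀ hq]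
  refine le_trans (le_of_eq ?_) hbound
  conv_lhs => rw [← abs_of_pos hq, ← abs_mul, abs_of_pos hq]
  congr 1
  field_simp

lemma card_filter_pow_eq_le [DecidableEq F] {d : ℕ} (hd : 0 < d) (c : F) :
    #{x : F | x ^ d = c} ≤ d := by
  calc #{x : F | x ^ d = c} ≤ #(Polynomial.nthRoots d c).toFinset := by
        refine card_le_card fun x hx => ?_
        simpa [Polynomial.mem_nthRoots hd] using hx
    _ ≤ d := (Multiset.toFinset_card_le _).trans (Polynomial.card_nthRoots d c)

lemma card_filter_pow_eq_pow_le [DecidableEq F] {d : ℕ} (hd : 0 < d) :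
    #{p : F × F | p.1 ^ d = p.2 ^ d} ≤ 1 + (Fintype.card F - 1) * d := by
  have h : #{p : F × F | p.1 ^ d = p.2 ^ d} = ∑ y : F, #{x : F | x ^ d = y ^ d} := by
    simp only [card_filter]
    rw [Fintype.sum_prod_type, sum_comm]
  rw [h, ← add_sum_erase _ _ (mem_univ (0 : F))]
  gcongr
  · simp [zero_pow hd.ne', pow_eq_zero_iff hd.ne', filter_eq']
  · refine (sum_le_card_nsmul _ _ d fun y _ => card_filter_pow_eq_le hd _).trans ?_
    simp [card_erase_of_mem]

/-- Weil's bound for monomial exponential sums, with constant `d` in place of `d - 1`. -/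
lemma norm_sum_addChar_mul_pow_le {ψ : AddChar F ℂ} (hψ : ψ.IsPrimitive) {d : ℕ} (hd : 0 < d)
    {a : F} (ha : a ≠ 0) :
    ‖∑ x, ψ (a * x ^ d)‖ ≤ d * √(Fintype.card F) := by
  classical
  set S : F → ℝ := fun c => ‖∑ x, ψ (c * x ^ d)‖ ^ 2 with hS
  have hS0 : S 0 = (Fintype.card F : ℝ) ^ 2 := by simp [hS]
  have hq : (1 : ℝ) < Fintype.card F := by exact_mod_cast Fintype.one_lt_card
  have hd' : (0 : ℝ) < d := by exact_mod_cast hd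
  have hinv (u : F) (hu : u ≠ 0) : S (a * u ^ d) = S a := by
    simp only [hS]
    congr 2
    refine Fintype.sum_equiv (Equiv.mulLeft₀ u hu) _ _ fun x => ?_
    simp [mul_pow, mul_assoc]
  have hmoment : ∑ c ∈ univ.erase 0, S c ≤ Fintype.card F * ((Fintype.card F - 1) * (d - 1)) := by
    have h := sum_norm_sq_sum_addChar hψ (fun x : F => x ^ d)
    change ∑ c, S c = _ at h
    rw [← add_sum_erase _ _ (mem_univ (0 : F)), hS0] at h
    have hc : (#{p : F × F | p.1 ^ d = p.2 ^ d} : ℝ) ≤ 1 + (Fintype.card F - 1) * d := by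
      have := card_filter_pow_eq_pow_le (F := F) hd
      rw [← Nat.cast_le (α := ℝ)] at this
      simpa [Nat.cast_sub Fintype.card_pos] using this
    have := mul_le_mul_of_nonneg_left hc (zero_le_one.trans hq.le)
    linarith
  have horbit : ((Fintype.card F : ℝ) - 1) * S a ≤ d * ∑ c ∈ univ.erase 0, S c := by
    have h1 : ∑ u ∈ univ.erase (0 : F), S (a * u ^ d) = ((Fintype.card F : ℝ) - 1) * S a := by
      rw [sum_congr rfl fun u hu => hinv u (ne_of_mem_erase hu), sum_const,
        card_erase_of_mem (mem_univ _), nsmul_eq_mul, card_univ, Nat.cast_sub Fintype.card_pos,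
        Nat.cast_one]
    have hmaps : ∀ u ∈ univ.erase (0 : F), a * u ^ d ∈ univ.erase (0 : F) := fun u hu => by
      simpa [ha, hd.ne'] using hu
    rw [← h1, ← sum_fiberwise_of_maps_to hmaps, mul_sum]
    refine sum_le_sum fun c _ => ?_
    rw [sum_congr rfl fun u hu => congrArg S (mem_filter.1 hu).2, sum_const, nsmul_eq_mul]
    refine mul_le_mul_of_nonneg_right ?_ (sq_nonneg _)
    refine Nat.cast_le.2 (le_trans (card_le_card fun u hu => ?_)
      (card_filter_pow_eq_le hd (a⁻¹ * c)))
    rw [mem_filter] at hu ⊢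
    refine ⟨mem_univ _, ?_⟩
    rw [← hu.2, inv_mul_cancel_left₀ ha]
  have hSa : S a ≤ d ^ 2 * Fintype.card F := by
    have h := horbit.trans (mul_le_mul_of_nonneg_left hmoment hd'.le)
    have hq1 : (0 : ℝ) < Fintype.card F - 1 := sub_pos.2 hq
    rw [← mul_le_mul_iff_right₀ hq1]
    have : (0 : ℝ) ≤ d * (Fintype.card F * (Fintype.card F - 1)) := by positivity
    linarith
  refine (pow_le_pow_iff_left₀ (norm_nonneg _) (by positivity) two_ne_zero).1 ?_
  rwa [mul_pow, Real.sq_sqrt (Nat.cast_nonneg _)]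

/-- Exponential sums of diagonal forms factor. -/
lemma sum_addChar_diagonal {t : ℕ} (ψ : AddChar F ℂ) (a : Fin t → F) (d : Fin t → ℕ) (c : F) :
    ∑ x : Fin t → F, ψ (c * ∑ j, a j * x j ^ d j) = ∏ j, ∑ y, ψ (c * a j * y ^ d j) := by
  rw [prod_univ_sum, Fintype.piFinset_univ]
  refine sum_congr rfl fun x _ => ?_
  simp_rw [mul_sum, ← mul_assoc]
  exact map_prod ψ.toMonoidHom (fun j => Multiplicative.ofAdd (c * a j * x j ^ d j)) univ

end CharacterSums


/-- Weil-type estimate for a single diagonal equation with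
distinct degrees. -/
theorem single_diagonal_equation_estimate
    (q t : ℕ) (hq : IsPrimePow q)
    (F : Type*) [Field F] [Fintype F] (hFq : Fintype.card F = q)
    (ht : 3 ≤ t)
    (d : Fin t → ℕ) (hd : StrictAnti d) (hd2 : ∀ i, 2 ≤ d i)
    (hchar : ∀ i, ¬ (ringChar F ∣ d i))
    (a : Fin t → F) (ha : ∀ i, a i ≠ 0) (b : F)
    (N : ℕ)
    (hN : N = Set.ncard {x : Fin t → F | ∑ j, a j * x j ^ d j = b}) :
    |(N : ℝ) - (q : ℝ) ^ (t - 1)|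
      ≤ (q : ℝ) ^ ((t : ℝ) / 2)
        * ((6 * d ⟨0, Nat.lt_of_lt_of_le (by norm_num) ht⟩ : ℕ) : ℝ) ^ (t + 1) := by
  classical
  have hψ := AddChar.FiniteField.primitiveChar_to_Complex_isPrimitive F
  set ψ := AddChar.FiniteField.primitiveChar_to_Complex F
  set D := d ⟨0, Nat.lt_of_lt_of_le (by norm_num) ht⟩
  have hdD (i : Fin t) : d i ≤ D := hd.antitone (Fin.mk_le_of_le_val (Nat.zero_le _))
  have hD1 : 1 ≤ D := (hd2 _).trans' one_le_two
  have hq0 : (q : ℝ) ≠ 0 := by exact_mod_cast hq.pos.ne'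
  have hsum (c : F) (hc : c ≠ 0) :
      ‖∑ x : Fin t → F, ψ (c * ∑ j, a j * x j ^ d j)‖ ≤ (D * √q) ^ t := by
    rw [sum_addChar_diagonal, norm_prod]
    calc _ ≤ ∏ _j : Fin t, (D * √q) := by
          refine Finset.prod_le_prod (fun _ _ => norm_nonneg _) fun j _ => ?_
          refine (norm_sum_addChar_mul_pow_le hψ (two_pos.trans_le (hd2 j))
            (mul_ne_zero hc (ha j))).trans ?_
          rw [hFq]
          gcongr
          exact hdD j
      _ = _ := by simp
  have h := abs_card_fiber_sub_le hψ (fun x : Fin t → F => ∑ j, a j * x j ^ d j) b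
    (by positivity) hsum
  have hcard : (Fintype.card (Fin t → F) : ℝ) / Fintype.card F = (q : ℝ) ^ (t - 1) := by
    rw [Fintype.card_fun, Fintype.card_fin, hFq, Nat.cast_pow, div_eq_iff hq0,
      pow_sub_one_mul (by omega)]
  have hNcard : N = (Finset.univ.filter fun x : Fin t → F => ∑ j, a j * x j ^ d j = b).card := by
    rw [hN, ← Set.ncard_coe_finset]
    simp
  rw [hcard, ← hNcard] at h
  refine h.trans ?_
  have hsqrt : √(q : ℝ) ^ t = (q : ℝ) ^ ((t : ℝ) / 2) := by
    rw [Real.sqrt_eq_rpow, ← Real.rpow_natCast, ← Real.rpow_mul (Nat.cast_nonneg q)]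
    ring_nf
  rw [mul_pow, mul_comm, hsqrt]
  refine mul_le_mul_of_nonneg_left ?_ (by positivity)
  have h6 : D ≤ 6 * D := by omega
  exact_mod_cast (Nat.pow_le_pow_left h6 t).trans (Nat.pow_le_pow_right (by omega) t.le_succ)
end

section
/- Let q be a prime power and 𝔽_q the finite field with q elements. Let t, n, d_1, …, d_t be positive integers with n < (t−1)/2, d_1 > d_2 > ⋯ > d_t ≥ 2, and suppose char(𝔽_q) does not divide d_i for 1 ≤ i ≤ t. Let A = (a_{ij}) ∈ 𝔽_q^{n×t} satisfy hypothesis (H). Let c_{jl} (1 ≤ j, l ≤ n) be positive integers with c_{j1} + ⋯ + c_{jn} < d_t for every j, let a_1, …, a_n ∈ 𝔽_q with a_j ≠ 0 for at least one j, and let b_1, …, b_n ∈ 𝔽_q all be nonzero. Let N be the number of tuples x = (x_1, …, x_t) ∈ 𝔽_q^t such that ∑_{l=1}^t a_{jl} x_l^{d_l} + a_j = b_j · x_1^{c_{j1}} ⋯ x_n^{c_{jn}} for every 1 ≤ j ≤ n. Then |N − q^{t−n}| ≤ q^{t/2} · (6 n d_1)^{t+1}. -/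
open Finset in
theorem sum_norm_sq_charSum {V X : Type*} [AddCommGroup V] [Fintype V] [DecidableEq V]
    [Fintype X] (f : X → V) :
    ∑ χ : AddChar V ℂ, ‖∑ x, χ (f x)‖ ^ 2
      = (Fintype.card V : ℝ) * #{p : X × X | f p.1 = f p.2} := by
  have key : ∀ χ : AddChar V ℂ, ((‖∑ x, χ (f x)‖ ^ 2 : ℝ) : ℂ)
      = ∑ p : X × X, χ (f p.1 - f p.2) := by
    intro χ
    push_cast
    rw [← Complex.mul_conj', map_sum, Fintype.sum_mul_sum, Fintype.sum_prod_type]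
    simp [sub_eq_add_neg, AddChar.map_add_eq_mul, AddChar.map_neg_eq_conj]
  have : ((∑ χ : AddChar V ℂ, ‖∑ x, χ (f x)‖ ^ 2 : ℝ) : ℂ)
      = ((Fintype.card V : ℝ) * #{p : X × X | f p.1 = f p.2} : ℝ) := by
    rw [Complex.ofReal_sum, sum_congr rfl fun χ _ ↦ key χ, sum_comm]
    simp_rw [AddChar.sum_apply_eq_ite, sub_eq_zero]
    rw [← sum_filter]
    simp [mul_comm]
  exact_mod_cast this

open Finset in
theorem card_eq_pairs_sub_sq_le {V X Y : Type*} [AddCommGroup V] [Fintype V] [DecidableEq V]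
    [Fintype X] [Fintype Y] (f : X → V) (h : Y → V) :
    ((Fintype.card V : ℝ) * #{p : X × Y | f p.1 = h p.2} - Fintype.card X * Fintype.card Y) ^ 2
      ≤ (∑ χ : AddChar V ℂ, ‖∑ x, χ (f x)‖ ^ 2) *
        ∑ χ ∈ ({0}ᶜ : Finset (AddChar V ℂ)), ‖∑ y, χ (h y)‖ ^ 2 := by
  have hsum : (Fintype.card V : ℂ) * #{p : X × Y | f p.1 = h p.2} -
      Fintype.card X * Fintype.card Y =
      ∑ χ ∈ ({0}ᶜ : Finset (AddChar V ℂ)),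
        (∑ x, χ (f x)) * (starRingEnd ℂ) (∑ y, χ (h y)) := by
    rw [sub_eq_iff_eq_add', eq_comm]
    have := Fintype.sum_eq_add_sum_compl (0 : AddChar V ℂ)
      (fun χ ↦ (∑ x, χ (f x)) * (starRingEnd ℂ) (∑ y, χ (h y)))
    simp only [AddChar.zero_apply, sum_const, card_univ, nsmul_eq_mul, mul_one, map_natCast]
      at this
    rw [← this]
    have key : ∀ χ : AddChar V ℂ, (∑ x, χ (f x)) * (starRingEnd ℂ) (∑ y, χ (h y))
        = ∑ p : X × Y, χ (f p.1 - h p.2) := by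
      intro χ
      rw [map_sum, Fintype.sum_mul_sum, Fintype.sum_prod_type]
      simp [sub_eq_add_neg, AddChar.map_add_eq_mul, AddChar.map_neg_eq_conj]
    rw [sum_congr rfl fun χ _ ↦ key χ, sum_comm]
    simp_rw [AddChar.sum_apply_eq_ite, sub_eq_zero]
    rw [← sum_filter]
    simp [mul_comm]
  have habs : |(Fintype.card V : ℝ) * #{p : X × Y | f p.1 = h p.2} -
      Fintype.card X * Fintype.card Y| ≤ ∑ χ ∈ ({0}ᶜ : Finset (AddChar V ℂ)),
        ‖∑ x, χ (f x)‖ * ‖∑ y, χ (h y)‖ := by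
    rw [← Real.norm_eq_abs, ← Complex.norm_real]
    push_cast
    rw [hsum]
    refine (norm_sum_le _ _).trans_eq (sum_congr rfl fun χ _ ↦ ?_)
    rw [norm_mul, RCLike.norm_conj]
  rw [← sq_abs]
  calc _ ≤ (∑ χ ∈ ({0}ᶜ : Finset (AddChar V ℂ)),
        ‖∑ x, χ (f x)‖ * ‖∑ y, χ (h y)‖) ^ 2 := by gcongr
    _ ≤ _ := sum_mul_sq_le_sq_mul_sq _ _ _
    _ ≤ _ := by
      gcongr
      exact subset_univ _

open Finset in
theorem card_pow_eq_le {F : Type*} [Field F] [Fintype F] [DecidableEq F] {e : ℕ} (he : 0 < e)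
    (a : F) : #{x : F | x ^ e = a} ≤ e := by
  calc #{x : F | x ^ e = a} ≤ #(Polynomial.nthRoots e a).toFinset := by
        refine card_le_card fun x hx ↦ ?_
        simpa [Polynomial.mem_nthRoots he] using hx
    _ ≤ _ := (Multiset.toFinset_card_le _).trans (Polynomial.card_nthRoots e a)

open Finset in
theorem norm_sq_sum_addChar_pow_le {F : Type*} [Field F] [Fintype F] {e : ℕ} (he : 0 < e)
    {ψ : AddChar F ℂ} (hψ : ψ ≠ 0) :
    ‖∑ x, ψ (x ^ e)‖ ^ 2 ≤ 2 * e ^ 2 * (Fintype.card F : ℝ) := by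
  classical
  set q : ℕ := Fintype.card F with hq
  have hinj : Function.Injective ψ.mulShift :=
    AddChar.to_mulShift_inj_of_isPrimitive (AddChar.IsPrimitive.of_ne_one hψ)
  set G : AddChar F ℂ → ℝ := fun χ ↦ ‖∑ x, χ (x ^ e)‖ ^ 2 with hG
  have htwist : ∀ z ∈ ({0}ᶜ : Finset F), G (ψ.mulShift (z ^ e)) = G ψ := by
    intro z hz
    have hz : z ≠ 0 := by simpa using hz
    simp only [hG, AddChar.mulShift_apply, ← mul_pow]
    rw [Fintype.sum_equiv (Equiv.mulLeft₀ z hz) (fun x ↦ ψ ((z * x) ^ e)) (fun x ↦ ψ (x ^ e))]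
    simp
  have hpairs : #{p : F × F | p.1 ^ e = p.2 ^ e} ≤ q * e := by
    have := card_le_mul_card_image_of_maps_to (f := Prod.snd)
      (s := ({p : F × F | p.1 ^ e = p.2 ^ e} : Finset _)) (t := univ) (by simp) e
      (fun y _ ↦ ?_)
    · rwa [card_univ, mul_comm] at this
    · refine le_trans ?_ (card_pow_eq_le he (y ^ e))
      refine card_le_card_of_injOn Prod.fst (fun p hp ↦ ?_) (fun p hp p' hp' h ↦ ?_)
      · simp only [mem_filter, mem_univ, true_and, coe_filter, Set.mem_ofPred_eq] at hp ⊢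
        rw [hp.1, hp.2]
      · simp only [mem_filter, mem_univ, true_and, coe_filter, Set.mem_ofPred_eq] at hp hp'
        exact Prod.ext h (hp.2.trans hp'.2.symm)
  have hmom : ∑ χ, G χ ≤ (q : ℝ) * (q * e) := by
    rw [hG, sum_norm_sq_charSum]
    gcongr
    exact_mod_cast hpairs
  have hsum : ∑ z ∈ ({0}ᶜ : Finset F), G (ψ.mulShift (z ^ e)) ≤ e * ∑ χ, G χ := by
    rw [← sum_fiberwise_of_maps_to (s := ({0}ᶜ : Finset F)) (t := univ)
      (g := fun z ↦ ψ.mulShift (z ^ e)) (by simp), mul_sum]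
    refine sum_le_sum fun χ _ ↦ ?_
    rw [sum_congr rfl (g := fun _ ↦ G χ) fun z hz ↦ by rw [(mem_filter.1 hz).2], sum_const,
      nsmul_eq_mul]
    refine mul_le_mul_of_nonneg_right ?_ (by positivity)
    norm_cast
    by_cases hχ : ∃ a, ψ.mulShift a = χ
    · obtain ⟨a, rfl⟩ := hχ
      refine le_trans (card_le_card fun z hz ↦ ?_) (card_pow_eq_le he a)
      simpa using hinj (mem_filter.1 hz).2
    · rw [card_eq_zero.2]
      · exact Nat.zero_le _
      · exact filter_eq_empty_iff.2 fun z _ h ↦ hχ ⟨_, h⟩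
  rw [sum_congr rfl htwist, sum_const, nsmul_eq_mul, card_compl, card_singleton, ← hq] at hsum
  have hq2 : 2 ≤ q := Fintype.one_lt_card
  have hcast : ((q - 1 : ℕ) : ℝ) = q - 1 := by push_cast [Nat.cast_sub (by omega : 1 ≤ q)]; ring
  rw [hcast] at hsum
  have hq2' : (2 : ℝ) ≤ q := by exact_mod_cast hq2
  have hG0 : 0 ≤ G ψ := by positivity
  have h1 : (q : ℝ) * G ψ ≤ q * (2 * e ^ 2 * q) := by
    have h2 : (e : ℝ) * ∑ χ, G χ ≤ e * (q * (q * e)) := by gcongr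
    nlinarith
  exact le_of_mul_le_mul_left h1 (by linarith)

/-- The restriction of an additive character of `F ^ n` to the line through the `l`-th column
of `B`. -/
noncomputable def Matrix.colChar {F ι κ : Type*} [Field F] (B : Matrix ι κ F)
    (χ : AddChar (ι → F) ℂ) (l : κ) : AddChar F ℂ :=
  χ.compAddMonoidHom (LinearMap.toSpanSingleton F (ι → F) (B.transpose l)).toAddMonoidHom

theorem Matrix.colChar_apply {F ι κ : Type*} [Field F] (B : Matrix ι κ F)
    (χ : AddChar (ι → F) ℂ) (l : κ) (y : F) : B.colChar χ l y = χ (y • B.transpose l) := rfl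

theorem AddChar.map_finset_sum_eq_prod {V κ : Type*} [AddCommMonoid V] (χ : AddChar V ℂ)
    (s : Finset κ) (f : κ → V) : χ (∑ l ∈ s, f l) = ∏ l ∈ s, χ (f l) := by
  classical
  induction s using Finset.induction_on with
  | empty => simp
  | insert l s hl ih => simp [Finset.sum_insert hl, Finset.prod_insert hl, ih,
      AddChar.map_add_eq_mul]

theorem Matrix.prod_colChar {F ι κ : Type*} [Field F] [Fintype κ] (B : Matrix ι κ F)
    (χ : AddChar (ι → F) ℂ) (w : κ → F) :
    ∏ l, B.colChar χ l (w l) = χ (B.mulVec w) := by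
  simp_rw [Matrix.colChar_apply]
  rw [← AddChar.map_finset_sum_eq_prod, Matrix.mulVec_eq_sum]
  simp

theorem Matrix.addChar_ext_of_colChar {F : Type*} [Field F] {n : ℕ} {κ : Type*}
    {B : Matrix (Fin n) κ F} {φ : Fin n → κ} (hφ : (B.submatrix id φ).det ≠ 0)
    {χ χ' : AddChar (Fin n → F) ℂ} (h : ∀ i, B.colChar χ (φ i) = B.colChar χ' (φ i)) :
    χ = χ' := by
  ext v
  have hu : IsUnit (B.submatrix id φ).det := hφ.isUnit
  have hv : (B.submatrix id φ).mulVec ((B.submatrix id φ)⁻¹.mulVec v) = v := by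
    rw [Matrix.mulVec_mulVec, Matrix.mul_nonsing_inv _ hu, Matrix.one_mulVec]
  rw [← hv, ← Matrix.prod_colChar, ← Matrix.prod_colChar]
  exact Finset.prod_congr rfl fun i _ ↦ DFunLike.congr_fun (h i) _

open Finset in
open scoped Classical in
theorem Matrix.card_colChar_eq_zero_mul_le {F : Type*} [Field F] [Fintype F] {n m : ℕ}
    (hnm : n ≤ m) {B : Matrix (Fin n) (Fin m) F}
    (hB : ∀ φ : Fin n ↪ Fin m, (B.submatrix id φ).det ≠ 0) (K : Finset (Fin m)) :
    #{χ ∈ ({0}ᶜ : Finset (AddChar (Fin n → F) ℂ)) | ∀ l ∈ K, B.colChar χ l = 0}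
      * Fintype.card F ^ #K ≤ Fintype.card F ^ n := by
  obtain hK | hK := le_total #K n
  · obtain ⟨T, hKT, -, hT⟩ := exists_subsuperset_card_eq (subset_univ K) hK (by simpa using hnm)
    set φ : Fin n ↪ Fin m := (T.orderEmbOfFin hT).toEmbedding with hφ
    have hrange : ∀ l ∈ K, ∃ i, φ i = l := by
      intro l hl
      have : l ∈ Set.range (T.orderEmbOfFin hT) := by
        rw [range_orderEmbOfFin]; exact hKT hl
      exact this
    let S := {χ ∈ ({0}ᶜ : Finset (AddChar (Fin n → F) ℂ)) | ∀ l ∈ K, B.colChar χ l = 0}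
    let g : S × (K → AddChar F ℂ) → (Fin n → AddChar F ℂ) := fun p i ↦
      if h : φ i ∈ K then p.2 ⟨φ i, h⟩ else B.colChar p.1.1 (φ i)
    have hg : Function.Injective g := by
      rintro ⟨χ, z⟩ ⟨χ', z'⟩ h
      refine Prod.ext (Subtype.ext (Matrix.addChar_ext_of_colChar (hB φ) fun i ↦ ?_)) ?_
      · by_cases hi : φ i ∈ K
        · rw [(mem_filter.1 χ.2).2 _ hi, (mem_filter.1 χ'.2).2 _ hi]
        · simpa [g, hi] using congr_fun h i
      · ext1 ⟨l, hl⟩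
        obtain ⟨i, rfl⟩ := hrange l hl
        simpa [g, hl] using congr_fun h i
    have := Fintype.card_le_of_injective g hg
    rw [Fintype.card_prod, Fintype.card_coe] at this
    simpa using this
  · obtain ⟨T, hTK, hT⟩ := exists_subset_card_eq hK
    rw [card_eq_zero.2, zero_mul]
    · exact Nat.zero_le _
    refine filter_eq_empty_iff.2 fun χ hχ h ↦ ?_
    refine (by simpa using hχ : χ ≠ 0) ?_
    refine Matrix.addChar_ext_of_colChar (hB (T.orderEmbOfFin hT).toEmbedding) fun i ↦ ?_
    exact h _ (hTK (orderEmbOfFin_mem T hT i))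

open Finset in
theorem Matrix.sum_norm_sq_charSum_diagonal_le {F : Type*} [Field F] [Fintype F] {n m : ℕ}
    (hnm : n ≤ m) {B : Matrix (Fin n) (Fin m) F}
    (hB : ∀ φ : Fin n ↪ Fin m, (B.submatrix id φ).det ≠ 0) {e : Fin m → ℕ}
    (he : ∀ l, 0 < e l) :
    ∑ χ ∈ ({0}ᶜ : Finset (AddChar (Fin n → F) ℂ)),
        ‖∑ y : Fin m → F, χ (B.mulVec fun l ↦ y l ^ e l)‖ ^ 2
      ≤ (Fintype.card F : ℝ) ^ (m + n) * ∏ l, (2 * (e l : ℝ) ^ 2 + 1) := by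
  classical
  set q : ℝ := (Fintype.card F : ℝ) with hq
  have hfactor : ∀ χ : AddChar (Fin n → F) ℂ,
      ‖∑ y : Fin m → F, χ (B.mulVec fun l ↦ y l ^ e l)‖ ^ 2
        ≤ q ^ m * ∏ l, (2 * (e l : ℝ) ^ 2 + if B.colChar χ l = 0 then q else 0) := by
    intro χ
    simp_rw [← Matrix.prod_colChar]
    rw [← Fintype.prod_sum (fun l x ↦ B.colChar χ l (x ^ e l)), norm_prod, ← prod_pow]
    have : q ^ m = ∏ _l : Fin m, q := by simp
    rw [this, ← prod_mul_distrib]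
    refine prod_le_prod (fun _ _ ↦ by positivity) fun l _ ↦ ?_
    split_ifs with h
    · have : (0 : ℝ) ≤ q * (2 * (e l : ℝ) ^ 2) := by positivity
      simp [h, ← hq]
      nlinarith
    · rw [add_zero, mul_comm]
      exact norm_sq_sum_addChar_pow_le (he l) h
  refine (sum_le_sum fun χ _ ↦ hfactor χ).trans ?_
  rw [← mul_sum, pow_add, mul_assoc]
  refine mul_le_mul_of_nonneg_left ?_ (by positivity)
  simp_rw [Fintype.prod_add]
  rw [sum_comm, mul_sum]
  refine sum_le_sum fun T _ ↦ ?_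
  rw [← mul_sum, prod_const_one, mul_one, mul_comm]
  refine mul_le_mul_of_nonneg_right ?_ (by positivity)
  have hprod : ∀ χ : AddChar (Fin n → F) ℂ,
      (∏ l ∈ Tᶜ, if B.colChar χ l = 0 then q else 0)
        = if ∀ l ∈ Tᶜ, B.colChar χ l = 0 then q ^ #Tᶜ else 0 := by
    intro χ
    by_cases hT : ∀ l ∈ Tᶜ, B.colChar χ l = 0
    · rw [prod_ite_zero, if_pos hT, if_pos hT, prod_const]
    · rw [prod_ite_zero, if_neg hT, if_neg hT]
  simp_rw [hprod]
  rw [← sum_filter, sum_const, nsmul_eq_mul, hq]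
  exact_mod_cast Matrix.card_colChar_eq_zero_mul_le hnm hB Tᶜ

open MvPolynomial in
theorem card_le_prod_of_pow_eq_eval {F ι : Type*} [Field F] [Fintype F] [Fintype ι]
    (Z : Finset (ι → F)) {d : ι → ℕ} {g : ι → MvPolynomial ι F}
    (hg : ∀ i, (g i).totalDegree < d i) (hZ : ∀ z ∈ Z, ∀ i, z i ^ d i = eval z (g i)) :
    Z.card ≤ ∏ i, d i := by
  classical
  let r : MvPolynomial ι F →ₗ[F] (Z → F) :=
    (LinearMap.funLeft F F (Subtype.val : Z → ι → F)).comp (evalₗ F ι)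
  have hr : ∀ p z, r p z = eval z.1 p := fun _ _ ↦ rfl
  let v : ((i : ι) → Fin (d i)) → (Z → F) := fun e z ↦ ∏ i, z.1 i ^ (e i : ℕ)
  have hmem : ∀ k (p : MvPolynomial ι F), p.totalDegree < k →
      r p ∈ Submodule.span F (Set.range v) := by
    intro k
    induction k with
    | zero => intro p hp; omega
    | succ k ih =>
      intro p hp
      rw [p.as_sum, map_sum]
      refine Submodule.sum_mem _ fun s hs ↦ ?_
      by_cases hlt : ∀ i, s i < d i
      · have : r (monomial s (coeff s p)) = coeff s p • v fun i ↦ ⟨s i, hlt i⟩ := by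
          ext z
          simp [hr, v, eval_monomial, Finsupp.prod_fintype]
        rw [this]
        exact Submodule.smul_mem _ _ (Submodule.subset_span ⟨_, rfl⟩)
      · push Not at hlt
        obtain ⟨i, hi⟩ := hlt
        have hle : Finsupp.single i (d i) ≤ s := by
          rwa [Finsupp.single_le_iff]
        have hsplit : s = (s - Finsupp.single i (d i)) + Finsupp.single i (d i) :=
          (tsub_add_cancel_of_le hle).symm
        have : r (monomial s (coeff s p))
            = r (monomial (s - Finsupp.single i (d i)) (coeff s p) * g i) := by
          ext z
          rw [hr, hr, map_mul, ← hZ z.1 z.2 i]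
          generalize coeff s p = k₀
          conv_lhs => rw [hsplit, monomial_add_single]
          simp
        rw [this]
        apply ih
        have h1 := totalDegree_mul (monomial (s - Finsupp.single i (d i)) (coeff s p)) (g i)
        have h2 := totalDegree_monomial_le (s - Finsupp.single i (d i)) (coeff s p)
        have h3 := le_totalDegree hs
        have h4 : (s.sum fun _ e ↦ e)
            = ((s - Finsupp.single i (d i)).sum fun _ e ↦ e) + d i := by
          conv_lhs => rw [hsplit]
          rw [Finsupp.sum_add_index' (by simp) (by simp), Finsupp.sum_single_index rfl]
        have h5 := hg i
        have h6 : (s - Finsupp.single i (d i)).sum (fun _ ↦ id)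
            = (s - Finsupp.single i (d i)).sum fun _ e ↦ e := rfl
        omega
  have htop : Submodule.span F (Set.range v) = ⊤ := by
    refine top_unique fun f _ ↦ ?_
    have hf : (fun x ↦ if h : x ∈ Z then f ⟨x, h⟩ else 0)
        ∈ (restrictDegree ι F (Fintype.card F - 1)).map (evalₗ F ι) := by
      rw [map_restrict_dom_evalₗ]; trivial
    obtain ⟨p, -, hp⟩ := hf
    have : f = r p := by
      ext z
      have := congr_fun hp z.1
      rw [evalₗ_apply, dif_pos z.2] at this
      rw [hr, this]
    rw [this]
    exact hmem _ p (Nat.lt_succ_self _)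
  have hrank := finrank_range_le_card (R := F) v
  rw [Set.finrank, htop, finrank_top] at hrank
  simpa using hrank

open MvPolynomial in
theorem card_filter_diagonal_sub_monomial_le {F : Type*} [Field F] [Fintype F] [DecidableEq F]
    {n : ℕ} {A : Matrix (Fin n) (Fin n) F} (hA : A.det ≠ 0) {d : Fin n → ℕ}
    {c : Fin n → Fin n → ℕ} (hcd : ∀ j i, ∑ l, c j l < d i) (b v : Fin n → F) :
    (Finset.univ.filter fun x : Fin n → F ↦
      ∀ j, b j * ∏ l, x l ^ c j l - A.mulVec (fun l ↦ x l ^ d l) j = v j).card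
      ≤ ∏ i, d i := by
  refine card_le_prod_of_pow_eq_eval _
    (g := fun i ↦ ∑ j, C (A⁻¹ i j) * (C (b j) * ∏ l, X l ^ c j l - C (v j)))
    (fun i ↦ ?_) (fun x hx i ↦ ?_)
  · have hpos : 0 < d i := (Nat.zero_le _).trans_lt (hcd i i)
    refine (totalDegree_finsetSum _ _).trans_lt ((Finset.sup_lt_iff hpos).2 fun j _ ↦ ?_)
    refine (totalDegree_mul _ _).trans_lt ?_
    rw [totalDegree_C, zero_add]
    refine (totalDegree_sub _ _).trans_lt (max_lt ?_ (by simpa using hpos))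
    refine (totalDegree_mul _ _).trans_lt ?_
    rw [totalDegree_C, zero_add]
    refine (totalDegree_finsetProd _ _).trans_lt (lt_of_le_of_lt ?_ (hcd j i))
    exact Finset.sum_le_sum fun l _ ↦ by simp
  · have hx : A.mulVec (fun l ↦ x l ^ d l) = fun j ↦ b j * ∏ l, x l ^ c j l - v j := by
      ext j
      rw [← (Finset.mem_filter.1 hx).2 j]
      ring
    have : x i ^ d i = (A⁻¹.mulVec (A.mulVec fun l ↦ x l ^ d l)) i := by
      rw [Matrix.mulVec_mulVec, Matrix.nonsing_inv_mul _ hA.isUnit, Matrix.one_mulVec]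
    rw [this, hx]
    simp [Matrix.mulVec, dotProduct]

open Finset in
theorem card_markoffHurwitz_sub_sq_le {F : Type*} [Field F] [Fintype F] [DecidableEq F]
    {n m : ℕ} (hnm : n ≤ m) {A : Matrix (Fin n) (Fin n) F} (hA : A.det ≠ 0)
    {B : Matrix (Fin n) (Fin m) F} (hB : ∀ φ : Fin n ↪ Fin m, (B.submatrix id φ).det ≠ 0)
    {d : Fin n → ℕ} {e : Fin m → ℕ} (he : ∀ l, 0 < e l)
    {c : Fin n → Fin n → ℕ} (hcd : ∀ j i, ∑ l, c j l < d i) (a b : Fin n → F) :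
    ((#{p : (Fin n → F) × (Fin m → F) | ∀ j, b j * ∏ l, p.1 l ^ c j l
        - A.mulVec (fun l ↦ p.1 l ^ d l) j - a j = B.mulVec (fun l ↦ p.2 l ^ e l) j} : ℝ)
      - (Fintype.card F : ℝ) ^ m) ^ 2
      ≤ (Fintype.card F : ℝ) ^ (n + m) * ((∏ i, (d i : ℝ)) * ∏ l, (2 * (e l : ℝ) ^ 2 + 1)) := by
  set q : ℝ := (Fintype.card F : ℝ) with hq
  have hq0 : 0 < q := by rw [hq]; exact_mod_cast Fintype.card_pos
  let f : (Fin n → F) → (Fin n → F) := fun x j ↦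
    b j * ∏ l, x l ^ c j l - A.mulVec (fun l ↦ x l ^ d l) j - a j
  let h : (Fin m → F) → (Fin n → F) := fun y ↦ B.mulVec fun l ↦ y l ^ e l
  have hpairs : #{p : (Fin n → F) × (Fin n → F) | f p.1 = f p.2}
      ≤ (∏ i, d i) * Fintype.card F ^ n := by
    have := card_le_mul_card_image_of_maps_to (f := Prod.snd)
      (s := ({p : (Fin n → F) × (Fin n → F) | f p.1 = f p.2} : Finset _)) (t := univ) (by simp)
      (∏ i, d i) (fun y _ ↦ ?_)
    · simpa using this
    · refine le_trans ?_
        (card_filter_diagonal_sub_monomial_le hA hcd b (fun j ↦ f y j + a j))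
      refine card_le_card_of_injOn Prod.fst (fun p hp ↦ ?_) (fun p hp p' hp' h ↦ ?_)
      · simp only [mem_filter, mem_univ, true_and, coe_filter, Set.mem_ofPred_eq] at hp ⊢
        intro j
        rw [← hp.2, ← hp.1]
        simp [f]
      · simp only [mem_filter, mem_univ, true_and, coe_filter, Set.mem_ofPred_eq] at hp hp'
        exact Prod.ext h (hp.2.trans hp'.2.symm)
  have hmain := card_eq_pairs_sub_sq_le f h
  rw [sum_norm_sq_charSum] at hmain
  have hdiag := Matrix.sum_norm_sq_charSum_diagonal_le hnm hB he
  have hset : #{p : (Fin n → F) × (Fin m → F) | f p.1 = h p.2}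
      = #{p : (Fin n → F) × (Fin m → F) | ∀ j, b j * ∏ l, p.1 l ^ c j l
        - A.mulVec (fun l ↦ p.1 l ^ d l) j - a j = B.mulVec (fun l ↦ p.2 l ^ e l) j} := by
    congr 1
    ext p
    simp [f, h, funext_iff]
  rw [hset] at hmain
  set N : ℝ := (#{p : (Fin n → F) × (Fin m → F) | ∀ j, b j * ∏ l, p.1 l ^ c j l
        - A.mulVec (fun l ↦ p.1 l ^ d l) j - a j = B.mulVec (fun l ↦ p.2 l ^ e l) j} : ℝ)
  have hcard : ∀ k, ((Fintype.card (Fin k → F) : ℕ) : ℝ) = q ^ k := by intro k; simp [hq]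
  rw [hcard, hcard] at hmain
  refine le_of_mul_le_mul_left ?_ (by positivity : 0 < (q ^ n) ^ 2)
  calc (q ^ n) ^ 2 * (N - q ^ m) ^ 2 = (q ^ n * N - q ^ n * q ^ m) ^ 2 := by ring
    _ ≤ _ := hmain
    _ ≤ (q ^ n * ((∏ i, (d i : ℝ)) * q ^ n))
        * (q ^ (m + n) * ∏ l, (2 * (e l : ℝ) ^ 2 + 1)) := by
      gcongr
      rw [hq]
      exact_mod_cast hpairs
    _ = _ := by ring

/-- estimate for the number of solutions of a system of
generalized Markoff–Hurwitz-type equations. -/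
theorem markoff_hurwitz_system_estimate
    (q t n : ℕ) (hq : IsPrimePow q)
    (F : Type*) [Field F] [Fintype F] (hFq : Fintype.card F = q)
    (ht : 0 < t) (hn : 0 < n) (hnt : 2 * n + 2 ≤ t) (hnt' : n ≤ t)
    (d : Fin t → ℕ) (hd : StrictAnti d) (hd2 : ∀ i, 2 ≤ d i)
    (hchar : ∀ i, ¬ (ringChar F ∣ d i))
    (A : Matrix (Fin n) (Fin t) F)
    (hH : ∀ φ : Fin n ↪ Fin t, (A.submatrix id φ).det ≠ 0)
    (c : Fin n → Fin n → ℕ) (hc : ∀ j l, 0 < c j l)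
    (hcd : ∀ j, ∑ l, c j l < d ⟨t - 1, Nat.sub_lt ht Nat.one_pos⟩)
    (a : Fin n → F) (ha : ∃ j, a j ≠ 0)
    (b : Fin n → F) (hb : ∀ j, b j ≠ 0)
    (N : ℕ)
    (hN : N = Set.ncard {x : Fin t → F |
      ∀ j, ∑ l, A j l * x l ^ d l + a j
        = b j * ∏ l : Fin n, x (Fin.castLE hnt' l) ^ c j l}) :
    |(N : ℝ) - (q : ℝ) ^ (t - n)|
      ≤ (q : ℝ) ^ ((t : ℝ) / 2) * ((6 * n * d ⟨0, ht⟩ : ℕ) : ℝ) ^ (t + 1) := by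
  classical
  have hanti : ∀ l, d l ≤ d ⟨0, ht⟩ := fun l ↦ hd.antitone (Fin.mk_le_mk.2 (Nat.zero_le _))
  have hlast : ∀ l, d ⟨t - 1, Nat.sub_lt ht Nat.one_pos⟩ ≤ d l := fun l ↦
    hd.antitone (Fin.mk_le_mk.2 (by omega))
  set M : ℝ := ((6 * n * d ⟨0, ht⟩ : ℕ) : ℝ) with hM
  set d₀ := d ⟨0, ht⟩ with hd₀
  have hd₀1 : (2 : ℝ) ≤ d₀ := by exact_mod_cast hd2 _
  have hM6 : 6 * (d₀ : ℝ) ≤ M := by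
    rw [hM]
    exact_mod_cast Nat.mul_le_mul_right _ (by omega : 6 ≤ 6 * n)
  clear_value d₀ M
  obtain ⟨m, rfl⟩ : ∃ m, t = n + m := ⟨t - n, by omega⟩
  have hbound := card_markoffHurwitz_sub_sq_le (n := n) (m := m) (by omega)
    (A := A.submatrix id (Fin.castAdd m)) (hH (Fin.castAddEmb m))
    (B := A.submatrix id (Fin.natAdd n))
    (fun φ ↦ hH (φ.trans (Fin.natAddEmb n)))
    (d := fun i ↦ d (Fin.castAdd m i)) (e := fun l ↦ d (Fin.natAdd n l))
    (fun l ↦ Nat.zero_lt_two.trans_le (hd2 _)) (c := c)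
    (fun j i ↦ (hcd j).trans_le (hlast _)) a b
  have hcount : N = (Finset.univ.filter fun p : (Fin n → F) × (Fin m → F) ↦
      ∀ j, b j * ∏ l, p.1 l ^ c j l
        - (A.submatrix id (Fin.castAdd m)).mulVec (fun l ↦ p.1 l ^ d (Fin.castAdd m l)) j - a j
        = (A.submatrix id (Fin.natAdd n)).mulVec
          (fun l ↦ p.2 l ^ d (Fin.natAdd n l)) j).card := by
    rw [hN, ← Set.ncard_coe_finset,
      ← Set.ncard_image_of_injective _ (Fin.appendEquiv n m).injective]
    congr 1
    ext x
    rw [Equiv.image_eq_preimage_symm]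
    simp only [Set.mem_ofPred_eq, Set.mem_preimage, Finset.coe_filter, Finset.mem_univ, true_and]
    refine forall_congr' fun j ↦ ?_
    have hcast : ∀ l, Fin.castLE hnt' l = Fin.castAdd m l := fun _ ↦ rfl
    simp only [hcast, Fin.appendEquiv, Equiv.coe_fn_symm_mk, Matrix.mulVec, dotProduct,
      Matrix.submatrix_apply, id, Fin.sum_univ_add]
    constructor
    · intro h
      linear_combination -h
    · intro h
      linear_combination -h
  rw [← hcount, hFq] at hbound
  rw [Nat.add_sub_cancel_left]
  have hM0 : 12 ≤ M := by linarith
  refine abs_le_of_sq_le_sq (hbound.trans ?_) (by positivity)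
  have hD : ∏ i : Fin n, (d (Fin.castAdd m i) : ℝ) ≤ (M ^ 2) ^ n := by
    calc _ ≤ ∏ _i : Fin n, M ^ 2 := by
          refine Finset.prod_le_prod (fun _ _ ↦ by positivity) fun i _ ↦ ?_
          have : (d (Fin.castAdd m i) : ℝ) ≤ d₀ := by exact_mod_cast hanti _
          nlinarith
      _ = _ := by simp
  have hE : ∏ l : Fin m, (2 * (d (Fin.natAdd n l) : ℝ) ^ 2 + 1) ≤ (M ^ 2) ^ m := by
    calc _ ≤ ∏ _l : Fin m, M ^ 2 := by
          refine Finset.prod_le_prod (fun _ _ ↦ by positivity) fun l _ ↦ ?_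
          have h1 : (d (Fin.natAdd n l) : ℝ) ≤ d₀ := by exact_mod_cast hanti _
          have h2 : (d (Fin.natAdd n l) : ℝ) ^ 2 ≤ (d₀ : ℝ) ^ 2 := by gcongr
          have h3 : (6 * (d₀ : ℝ)) ^ 2 ≤ M ^ 2 := by gcongr
          nlinarith
      _ = _ := by simp
  have hqpow : ((q : ℝ) ^ (((n + m : ℕ) : ℝ) / 2)) ^ 2 = (q : ℝ) ^ (n + m) := by
    rw [← Real.rpow_natCast, ← Real.rpow_mul (Nat.cast_nonneg q), ← Real.rpow_natCast]
    congr 1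
    push_cast
    ring
  rw [mul_pow, hqpow]
  refine mul_le_mul_of_nonneg_left ?_ (by positivity)
  calc _ ≤ (M ^ 2) ^ n * (M ^ 2) ^ m := by gcongr
    _ = M ^ (2 * (n + m)) := by ring
    _ ≤ M ^ (2 * (n + m + 1)) := pow_le_pow_right₀ (by linarith) (by omega)
    _ = _ := by ring
end
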